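/- Let F be a connected self-similar set in ℝ^p (F = ⋃_{i=1}^m φ_i(F) for contractive similarities φ_1,…,φ_m, m ≥ 2) and 0 < α < 1. Then there exists a dense G_δ set 𝒢 in C₁^α(F) such that for every f ∈ 𝒢, dim_H f^{-1}(r) = D_*(α, F) for Lebesgue-almost every r ∈ f(F). -/

import Mathlib

open Set Metric MeasureTheory Filter

noncomputable section

abbrev Euc (p : ℕ) := EuclideanSpace ℝ (Fin p)

/-- The space `C₁^α(F)` of 1-Hölder-α functions on `F`, with the supremum metric. -/
def HolderBall (p : ℕ) (α : ℝ) (F : Set (Euc p)) :=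
  {f : BoundedContinuousFunction ↥F ℝ // ∀ x y : ↥F, |f x - f y| ≤ dist x y ^ α}

instance (p : ℕ) (α : ℝ) (F : Set (Euc p)) : MetricSpace (HolderBall p α F) :=
  inferInstanceAs (MetricSpace
    {f : BoundedContinuousFunction ↥F ℝ // ∀ x y : ↥F, |f x - f y| ≤ dist x y ^ α})

/-- `D_*^f(A) = sup{d : λ{r : dim_H (f⁻¹(r) ∩ A) ≥ d} > 0}`. -/
def DstarOn {p : ℕ} {F : Set (Euc p)} (f : ↥F → ℝ) (A : Set ↥F) : ℝ :=
  sSup {d : ℝ | 0 < volume {r : ℝ | ENNReal.ofReal d ≤ dimH (f ⁻¹' {r} ∩ A)}}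

/-- `D_*(α, F)`: the sup over dense `G_δ` subsets `𝒢` of `C₁^α(F)` of
`inf{D_*^f : f ∈ 𝒢}`. -/
def DstarAlpha (p : ℕ) (α : ℝ) (F : Set (Euc p)) : ℝ :=
  sSup {v : ℝ | ∃ G : Set (HolderBall p α F), Dense G ∧ IsGδ G ∧
    v = sInf ((fun f : HolderBall p α F =>
      DstarOn (fun x : ↥F => f.1 x) Set.univ) '' G)}


/-- Extension lemma: prescribing values on a family of points while staying close to `g`. -/
theorem hb_ext {p : ℕ} {α : ℝ} {F : Set (Euc p)} (hα0 : 0 < α) (hα1 : α < 1)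
    (hF : IsCompact F) {J : Type*} [Nonempty J] (a : J → ↥F) (h : J → ℝ)
    (hh : ∀ i j, h i - h j ≤ dist (a i) (a j) ^ α)
    (g : HolderBall p α F) (ε : ℝ) (hg : ∀ i, |h i - g.1 (a i)| ≤ ε) :
    ∃ f : HolderBall p α F, (∀ i, f.1 (a i) = h i) ∧ ∀ x, |f.1 x - g.1 x| ≤ ε := by
  have tri : ∀ x y z : ↥F, dist x z ^ α ≤ dist x y ^ α + dist y z ^ α := by
    intro x y z
    refine (Real.rpow_le_rpow dist_nonneg (dist_triangle x y z) hα0.le).trans ?_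
    exact Real.rpow_add_le_add_rpow dist_nonneg dist_nonneg hα0.le hα1.le
  have hgH : ∀ x y, g.1 x ≤ g.1 y + dist x y ^ α := fun x y => by
    have := (abs_le.1 (g.2 x y)).2; linarith
  have hε : 0 ≤ ε := (abs_nonneg _).trans (hg (Classical.arbitrary J))
  have ub : ∀ x i, h i - dist x (a i) ^ α ≤ g.1 x + ε := by
    intro x i
    have h1 := (abs_le.1 (hg i)).2
    have h2 := hgH (a i) x
    rw [dist_comm] at h2
    linarith
  have bdd : ∀ x, BddAbove (range fun i => h i - dist x (a i) ^ α) := fun x =>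
    ⟨g.1 x + ε, by rintro _ ⟨i, rfl⟩; exact ub x i⟩
  set e : ↥F → ℝ := fun x => max (g.1 x - ε) (⨆ i, (h i - dist x (a i) ^ α)) with he
  have eH : ∀ x y, e x ≤ e y + dist x y ^ α := by
    intro x y
    refine max_le ?_ ?_
    · have := hgH x y
      have := le_max_left (g.1 y - ε) (⨆ i, (h i - dist y (a i) ^ α))
      simp only [he]; linarith
    · refine ciSup_le fun i => ?_
      have h1 := le_max_right (g.1 y - ε) (⨆ i, (h i - dist y (a i) ^ α))
      have h2 := le_ciSup (bdd y) i
      have h3 := tri y x (a i)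
      rw [dist_comm y x] at h3
      simp only [he]
      linarith
  have eA : ∀ x y, |e x - e y| ≤ dist x y ^ α := by
    intro x y
    have h1 := eH x y
    have h2 := eH y x
    rw [dist_comm] at h2
    exact abs_le.2 ⟨by linarith, by linarith⟩
  have : CompactSpace ↥F := isCompact_iff_compactSpace.1 hF
  have ec : Continuous e := by
    rw [continuous_iff_continuousAt]
    intro x
    rw [ContinuousAt, tendsto_iff_dist_tendsto_zero]
    have : Tendsto (fun y : ↥F => dist y x ^ α) (nhds x) (nhds 0) := by
      have h : Continuous fun y : ↥F => dist y x ^ α :=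
        (continuous_id.dist continuous_const).rpow_const (fun _ => Or.inr hα0.le)
      have := h.tendsto x
      simpa [Real.zero_rpow hα0.ne'] using this
    exact squeeze_zero (fun _ => dist_nonneg) (fun y => by rw [Real.dist_eq]; exact eA y x) this
  refine ⟨⟨BoundedContinuousFunction.mkOfCompact ⟨e, ec⟩, eA⟩, ?_, ?_⟩
  · intro i
    change e (a i) = h i
    apply le_antisymm
    · refine max_le ?_ (ciSup_le fun j => ?_)
      · have := (abs_le.1 (hg i)).1; linarith
      · have := hh j i; rw [dist_comm] at this; linarith
    · refine le_trans ?_ (le_max_right _ _)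
      have := le_ciSup (bdd (a i)) i
      simpa [Real.zero_rpow hα0.ne'] using this
  · intro x
    change |e x - g.1 x| ≤ ε
    have h1 : e x ≤ g.1 x + ε := max_le (by linarith) (ciSup_le (ub x))
    have h2 : g.1 x - ε ≤ e x := le_max_left _ _
    exact abs_le.2 ⟨by linarith, by linarith⟩

theorem hb_dist {p : ℕ} {α : ℝ} {F : Set (Euc p)} (f g : HolderBall p α F) (x : ↥F) :
    |f.1 x - g.1 x| ≤ dist f g := by
  have := BoundedContinuousFunction.dist_coe_le_dist (f := f.1) (g := g.1) x
  rw [Real.dist_eq] at this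
  exact this

theorem hb_dist_le {p : ℕ} {α : ℝ} {F : Set (Euc p)} (f g : HolderBall p α F) {ε : ℝ}
    (hε : 0 ≤ ε) (h : ∀ x, |f.1 x - g.1 x| ≤ ε) : dist f g ≤ ε := by
  have : dist f.1 g.1 ≤ ε := (BoundedContinuousFunction.dist_le hε).2 fun x => by
    rw [Real.dist_eq]; exact h x
  exact this

/-- Smoothing: a dense family of strictly Hölder and Lipschitz functions. -/
theorem hb_smooth {p : ℕ} {α : ℝ} {F : Set (Euc p)} (hα0 : 0 < α) (hα1 : α < 1)
    (hF : IsCompact F) (hne : F.Nonempty) (g : HolderBall p α F) {δ : ℝ} (hδ : 0 < δ) :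
    ∃ g₁ : HolderBall p α F, dist g₁ g < δ ∧ ∃ θ > 0, ∃ L > 0,
      (∀ x y, |g₁.1 x - g₁.1 y| ≤ (1 - θ) * dist x y ^ α) ∧
      (∀ x y, |g₁.1 x - g₁.1 y| ≤ L * dist x y) := by
  have : Nonempty ↥F := hne.to_subtype
  have : CompactSpace ↥F := isCompact_iff_compactSpace.1 hF
  obtain ⟨η, hη, hηδ⟩ : ∃ η > 0, η ^ α < δ / 2 := by
    refine ⟨(δ / 4) ^ (1 / α), by positivity, ?_⟩
    rw [← Real.rpow_mul (by positivity), one_div, inv_mul_cancel₀ hα0.ne', Real.rpow_one]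
    linarith
  -- kernel estimates
  have kL : ∀ s t : ℝ, 0 ≤ s → 0 ≤ t → (t + η) ^ α ≤ (s + η) ^ α + η ^ (α - 1) * |t - s| := by
    intro s t hs ht
    rcases le_total t s with h | h
    · have := Real.rpow_le_rpow (by positivity : 0 ≤ t + η) (by linarith : t + η ≤ s + η) hα0.le
      have : 0 ≤ η ^ (α - 1) * |t - s| := by positivity
      linarith
    · rw [abs_of_nonneg (by linarith : 0 ≤ t - s)]
      have e1 : t + η = (s + η) * (1 + (t - s) / (s + η)) := by field_simp; ring
      have hu : 0 ≤ (t - s) / (s + η) := div_nonneg (by linarith) (by linarith)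
      rw [e1, Real.mul_rpow (by positivity) (by positivity)]
      have h2 : (1 + (t - s) / (s + η)) ^ α ≤ 1 + (t - s) / (s + η) := by
        calc _ ≤ (1 + (t - s) / (s + η)) ^ (1 : ℝ) :=
              Real.rpow_le_rpow_of_exponent_le (by linarith) hα1.le
          _ = _ := Real.rpow_one _
      have h3 : (s + η) ^ (α - 1) ≤ η ^ (α - 1) :=
        Real.rpow_le_rpow_of_nonpos hη (by linarith) (by linarith)
      have h4 : (s + η) ^ α = (s + η) ^ (α - 1) * (s + η) := by
        rw [← Real.rpow_add_one (by positivity)]; ring_nf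
      calc (s + η) ^ α * (1 + (t - s) / (s + η)) ^ α
          ≤ (s + η) ^ α * (1 + (t - s) / (s + η)) := by gcongr
        _ = (s + η) ^ α + (s + η) ^ (α - 1) * (t - s) := by
            rw [h4]; field_simp
        _ ≤ _ := by gcongr
  have kH : ∀ s t u : ℝ, 0 ≤ s → 0 ≤ t → 0 ≤ u → t ≤ s + u →
      (t + η) ^ α ≤ (s + η) ^ α + u ^ α := by
    intro s t u hs ht hu h
    refine (Real.rpow_le_rpow (by positivity) (by linarith : t + η ≤ (s + η) + u) hα0.le).trans ?_
    exact Real.rpow_add_le_add_rpow (by positivity) hu hα0.le hα1.le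
  have hgH : ∀ x y, g.1 x ≤ g.1 y + dist x y ^ α := fun x y => by
    have := (abs_le.1 (g.2 x y)).2; linarith
  have lb : ∀ x y, g.1 x ≤ g.1 y + (dist x y + η) ^ α := fun x y => by
    have := hgH x y
    have := Real.rpow_le_rpow dist_nonneg (by linarith : dist x y ≤ dist x y + η) hα0.le
    linarith
  have bdd : ∀ x, BddBelow (range fun y => g.1 y + (dist x y + η) ^ α) := fun x =>
    ⟨g.1 x, by rintro _ ⟨i, rfl⟩; exact lb x i⟩
  set e : ↥F → ℝ := fun x => ⨅ y, (g.1 y + (dist x y + η) ^ α) with he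
  have eH : ∀ x y, e x ≤ e y + dist x y ^ α := by
    intro x y
    rw [← sub_le_iff_le_add]
    refine le_ciInf fun z => ?_
    have h1 := ciInf_le (bdd x) z
    have h2 := kH (dist y z) (dist x z) (dist x y) dist_nonneg dist_nonneg dist_nonneg
      (by linarith [dist_triangle x y z])
    simp only [he]; linarith
  have eL : ∀ x y, e x ≤ e y + η ^ (α - 1) * dist x y := by
    intro x y
    rw [← sub_le_iff_le_add]
    refine le_ciInf fun z => ?_
    have h1 := ciInf_le (bdd x) z
    have h2 := kL (dist y z) (dist x z) dist_nonneg dist_nonneg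
    have h3 : η ^ (α - 1) * |dist x z - dist y z| ≤ η ^ (α - 1) * dist x y := by
      gcongr; exact abs_dist_sub_le x y z
    simp only [he]; linarith
  have e1 : ∀ x, g.1 x ≤ e x := fun x => le_ciInf (lb x)
  have e2 : ∀ x, e x ≤ g.1 x + η ^ α := fun x => by
    have := ciInf_le (bdd x) x
    simpa using this
  have eHa : ∀ x y, |e x - e y| ≤ dist x y ^ α := fun x y => by
    have h1 := eH x y
    have h2 := eH y x
    rw [dist_comm] at h2
    exact abs_le.2 ⟨by linarith, by linarith⟩
  have eLa : ∀ x y, |e x - e y| ≤ η ^ (α - 1) * dist x y := fun x y => by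
    have h1 := eL x y
    have h2 := eL y x
    rw [dist_comm] at h2
    exact abs_le.2 ⟨by linarith, by linarith⟩
  obtain ⟨θ, hθ0, hθ1, hθ⟩ : ∃ θ : ℝ, 0 < θ ∧ θ < 1 ∧ θ * (‖g.1‖ + δ) < δ / 4 := by
    have hn := norm_nonneg g.1
    refine ⟨δ / (8 * (‖g.1‖ + δ)), by positivity, ?_, ?_⟩
    · rw [div_lt_one (by positivity)]; linarith
    · have : δ / (8 * (‖g.1‖ + δ)) * (‖g.1‖ + δ) = δ / 8 := by field_simp
      rw [this]; linarith
  set e' : ↥F → ℝ := fun x => (1 - θ) * e x with he'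
  have sub : ∀ x y, |e' x - e' y| = (1 - θ) * |e x - e y| := fun x y => by
    simp only [he']
    rw [← mul_sub, abs_mul, abs_of_pos (by linarith : 0 < 1 - θ)]
  have ec : Continuous e' := by
    have : LipschitzWith (Real.toNNReal (η ^ (α - 1))) e :=
      LipschitzWith.of_dist_le_mul fun x y => by
        rw [Real.coe_toNNReal _ (by positivity), Real.dist_eq]; exact eLa x y
    exact continuous_const.mul this.continuous
  have h1 : ∀ x y, |e' x - e' y| ≤ (1 - θ) * dist x y ^ α := fun x y => by
    rw [sub]; exact mul_le_mul_of_nonneg_left (eHa x y) (by linarith)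
  refine ⟨⟨BoundedContinuousFunction.mkOfCompact ⟨e', ec⟩, fun x y => (h1 x y).trans ?_⟩, ?_,
    θ, hθ0, η ^ (α - 1), by positivity, h1, fun x y => ?_⟩
  · have : 0 ≤ dist x y ^ α := by positivity
    nlinarith
  · refine lt_of_le_of_lt (hb_dist_le _ g (ε := δ / 2 + δ / 4) (by positivity) fun x => ?_)
      (by linarith)
    change |(1 - θ) * e x - g.1 x| ≤ _
    have n1 : |g.1 x| ≤ ‖g.1‖ := g.1.norm_coe_le_norm x
    have n2 : |e x| ≤ ‖g.1‖ + δ := by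
      have := abs_le.1 n1
      exact abs_le.2 ⟨by linarith [e1 x], by linarith [e2 x]⟩
    have n3 : |θ * e x| ≤ δ / 4 := by
      rw [abs_mul, abs_of_pos hθ0]
      exact (mul_le_mul_of_nonneg_left n2 hθ0.le).trans hθ.le
    have n4 := abs_le.1 n3
    have := e1 x
    have := e2 x
    exact abs_le.2 ⟨by linarith, by linarith⟩
  · change |e' x - e' y| ≤ _
    rw [sub]
    refine le_trans ?_ (eLa x y)
    have : 0 ≤ |e x - e y| := abs_nonneg _
    nlinarith

open scoped ENNReal NNReal Topology

/-- Null sets for Hausdorff measure via open covers. -/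
theorem hnull_iff {Y : Type*} [MetricSpace Y] [MeasurableSpace Y] [BorelSpace Y] {s : ℝ}
    (hs : 0 < s) (K : Set Y) :
    μH[s] K = 0 ↔ ∀ n : ℕ, ∃ t : ℕ → Set Y, (∀ k, IsOpen (t k)) ∧ K ⊆ ⋃ k, t k ∧
      ∑' k, ediam (t k) ^ s < ((n : ℝ≥0∞) + 1)⁻¹ := by
  constructor
  · intro h n
    rw [Measure.hausdorffMeasure_apply] at h
    have h1 : (⨅ (t : ℕ → Set Y) (_ : K ⊆ ⋃ n, t n) (_ : ∀ n, ediam (t n) ≤ 1),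
          ∑' n, ⨆ _ : (t n).Nonempty, ediam (t n) ^ s) = 0 := by
      have := ENNReal.iSup_eq_zero.1 h 1
      exact ENNReal.iSup_eq_zero.1 this (by norm_num)
    set ε : ℝ≥0∞ := ((n : ℝ≥0∞) + 1)⁻¹ with hε
    have hε0 : ε ≠ 0 := by simp [hε]
    have hε2 : 0 < ε / 2 := ENNReal.half_pos hε0
    have hε3 : ε ≠ ∞ := by simp [hε]
    have h2 := h1.trans_lt hε2
    simp only [iInf_lt_iff] at h2
    obtain ⟨t, hK, hd, hsum⟩ := h2
    obtain ⟨ε', hε', hsε⟩ := ENNReal.exists_pos_sum_of_countable hε2.ne' ℕ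
    have hsup : ∀ k, (⨆ _ : (t k).Nonempty, ediam (t k) ^ s) = ediam (t k) ^ s := by
      intro k
      rcases (t k).eq_empty_or_nonempty with h | h
      · simp [h, ENNReal.zero_rpow_of_pos hs]
      · simp [h]
    simp only [hsup] at hsum
    have key : ∀ k, ∃ η : ℝ≥0, 0 < η ∧
        (ediam (t k) + 2 * (η : ℝ≥0∞)) ^ s < ediam (t k) ^ s + ε' k := by
      intro k
      have hfin : ediam (t k) ≠ ∞ := ((hd k).trans_lt (by norm_num)).ne
      have hc : Tendsto (fun η : ℝ≥0 => (ediam (t k) + 2 * (η : ℝ≥0∞)) ^ s) (𝓝 0)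
          (𝓝 ((ediam (t k) + 2 * ((0 : ℝ≥0) : ℝ≥0∞)) ^ s)) := by
        apply Continuous.tendsto
        refine ENNReal.continuous_rpow_const.comp ?_
        exact continuous_const.add
          ((ENNReal.continuous_const_mul (by norm_num)).comp ENNReal.continuous_coe)
      simp only [ENNReal.coe_zero, mul_zero, add_zero] at hc
      have hlt : ediam (t k) ^ s < ediam (t k) ^ s + ε' k :=
        ENNReal.lt_add_right (ENNReal.rpow_ne_top_of_nonneg hs.le hfin)
          (by simpa using (hε' k).ne')
      have h3 := hc.eventually (gt_mem_nhds hlt)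
      have h4 : ∀ᶠ η : ℝ≥0 in 𝓝[>] 0,
        (ediam (t k) + 2 * (η : ℝ≥0∞)) ^ s < ediam (t k) ^ s + ε' k := nhdsWithin_le_nhds h3
      obtain ⟨η, h5, h6⟩ := (h4.and self_mem_nhdsWithin).exists
      exact ⟨η, h6, h5⟩
    choose η hη hηs using key
    refine ⟨fun k => thickening (η k) (t k), fun k => isOpen_thickening, ?_, ?_⟩
    · refine hK.trans (iUnion_mono fun k => self_subset_thickening (by exact_mod_cast hη k) _)
    · calc ∑' k, ediam (thickening (η k) (t k)) ^ s
          ≤ ∑' k, (ediam (t k) ^ s + ε' k) := by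
            refine ENNReal.tsum_le_tsum fun k => ?_
            refine le_trans ?_ (hηs k).le
            exact ENNReal.rpow_le_rpow (ediam_thickening_le _) hs.le
        _ = ∑' k, ediam (t k) ^ s + ∑' k, (ε' k : ℝ≥0∞) := ENNReal.tsum_add
        _ < ε / 2 + ε / 2 := ENNReal.add_lt_add hsum hsε
        _ = ε := ENNReal.add_halves _
  · intro h
    rw [Measure.hausdorffMeasure_apply]
    refine ENNReal.iSup_eq_zero.2 fun r => ENNReal.iSup_eq_zero.2 fun hr => ?_
    refine le_antisymm (le_of_forall_gt fun ε hε => ?_) bot_le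
    have hm : 0 < min ε (r ^ s) := lt_min hε (by
      rcases eq_or_ne r ∞ with h | h
      · simp [h, ENNReal.top_rpow_of_pos hs]
      · exact ENNReal.rpow_pos hr h)
    obtain ⟨n, hn⟩ := ENNReal.exists_inv_nat_lt hm.ne'
    obtain ⟨t, -, hK, hsum⟩ := h n
    have hlt : ∑' k, ediam (t k) ^ s < min ε (r ^ s) :=
      hsum.trans_le ((ENNReal.inv_le_inv.2 le_self_add).trans hn.le)
    refine lt_of_le_of_lt ?_ (hlt.trans_le (min_le_left _ _))
    refine iInf_le_of_le t (iInf_le_of_le hK (iInf_le_of_le (fun k => ?_) ?_))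
    · have := (ENNReal.le_tsum (f := fun k => ediam (t k) ^ s) k).trans
        (hlt.le.trans (min_le_right _ _))
      exact (ENNReal.rpow_le_rpow_iff hs).1 this
    · exact ENNReal.tsum_le_tsum fun k => iSup_le fun _ => le_rfl

/-- Superlevel set in the product. -/
def bigE (p : ℕ) (α : ℝ) (F : Set (Euc p)) (d : ℝ) : Set (HolderBall p α F × ℝ) :=
  {z | ENNReal.ofReal d ≤ dimH ((fun x : ↥F => z.1.1 x) ⁻¹' {z.2})}

instance hbMeas (p : ℕ) (α : ℝ) (F : Set (Euc p)) : MeasurableSpace (HolderBall p α F) :=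
  borel _

instance hbBorel (p : ℕ) (α : ℝ) (F : Set (Euc p)) : BorelSpace (HolderBall p α F) := ⟨rfl⟩

theorem hb_cont_eval (p : ℕ) (α : ℝ) (F : Set (Euc p)) :
    Continuous fun z : ↥F × HolderBall p α F => z.2.1 z.1 := by
  have h : Continuous fun f : HolderBall p α F => (f.1 : BoundedContinuousFunction ↥F ℝ) :=
    continuous_subtype_val
  exact (h.comp continuous_snd).eval continuous_fst

theorem bigE_meas (p : ℕ) (α : ℝ) (F : Set (Euc p)) (hF : IsCompact F) {d : ℝ} (hd : 0 < d) :
    MeasurableSet (bigE p α F d) := by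
  have : CompactSpace ↥F := isCompact_iff_compactSpace.1 hF
  have hlev : ∀ O : Set ↥F, IsOpen O →
      IsOpen {z : HolderBall p α F × ℝ | (fun x : ↥F => z.1.1 x) ⁻¹' {z.2} ⊆ O} := by
    intro O hO
    rw [← isClosed_compl_iff]
    have hc : IsClosed {w : ↥F × (HolderBall p α F × ℝ) | w.2.1.1 w.1 = w.2.2 ∧ w.1 ∈ Oᶜ} := by
      refine IsClosed.inter ?_ (hO.isClosed_compl.preimage continuous_fst)
      refine isClosed_eq ?_ (continuous_snd.comp continuous_snd)
      exact (hb_cont_eval p α F).comp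
        (continuous_fst.prodMk (continuous_fst.comp continuous_snd))
    have := isClosedMap_snd_of_compactSpace _ hc
    convert this using 1
    ext z
    simp only [mem_compl_iff, mem_ofPred_eq, not_subset, mem_image, Prod.exists, mem_preimage,
      mem_singleton_iff]
    constructor
    · rintro ⟨x, hx, hxO⟩
      exact ⟨x, z.1, z.2, ⟨hx, hxO⟩, rfl⟩
    · rintro ⟨x, f, r, ⟨hx, hxO⟩, rfl⟩
      exact ⟨x, hx, hxO⟩
  have hnull : ∀ s : ℝ, 0 < s → MeasurableSet
      {z : HolderBall p α F × ℝ | μH[s] ((fun x : ↥F => z.1.1 x) ⁻¹' {z.2}) = 0} := by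
    intro s hs
    have : {z : HolderBall p α F × ℝ | μH[s] ((fun x : ↥F => z.1.1 x) ⁻¹' {z.2}) = 0} =
        ⋂ n : ℕ, ⋃ t : {t : ℕ → Set ↥F // (∀ k, IsOpen (t k)) ∧
          ∑' k, ediam (t k) ^ s < ((n : ℝ≥0∞) + 1)⁻¹},
          {z : HolderBall p α F × ℝ | (fun x : ↥F => z.1.1 x) ⁻¹' {z.2} ⊆ ⋃ k, t.1 k} := by
      ext z
      simp only [mem_ofPred_eq, hnull_iff hs, mem_iInter, mem_iUnion, Subtype.exists]
      refine forall_congr' fun n => exists_congr fun t => ?_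
      tauto
    rw [this]
    refine MeasurableSet.iInter fun n => IsOpen.measurableSet (isOpen_iUnion fun t => ?_)
    exact hlev _ (isOpen_iUnion t.2.1)
  have hEq : bigE p α F d = ⋂ n : ℕ,
      {z : HolderBall p α F × ℝ |
        μH[d * (1 - 1 / ((n : ℝ) + 2))] ((fun x : ↥F => z.1.1 x) ⁻¹' {z.2}) = 0}ᶜ := by
    have hpos : ∀ n : ℕ, 0 < d * (1 - 1 / ((n : ℝ) + 2)) := fun n => by
      have : 1 / ((n : ℝ) + 2) < 1 := by
        rw [div_lt_one (by positivity)]; linarith [Nat.cast_nonneg (α := ℝ) n]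
      exact mul_pos hd (by linarith)
    ext z
    simp only [bigE, mem_ofPred_eq, mem_iInter, mem_compl_iff]
    constructor
    · intro h n h0
      have hlt : ((d * (1 - 1 / ((n : ℝ) + 2))).toNNReal : ℝ≥0∞) <
          dimH ((fun x : ↥F => z.1.1 x) ⁻¹' {z.2}) := by
        refine lt_of_lt_of_le ?_ h
        change ENNReal.ofReal _ < _
        rw [ENNReal.ofReal_lt_ofReal_iff hd]
        have : 0 < 1 / ((n : ℝ) + 2) := by positivity
        nlinarith
      have := hausdorffMeasure_of_lt_dimH hlt
      rw [Real.coe_toNNReal _ (hpos n).le, h0] at this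
      simp at this
    · intro h
      have hn : ∀ n : ℕ, ENNReal.ofReal (d * (1 - 1 / ((n : ℝ) + 2))) ≤
          dimH ((fun x : ↥F => z.1.1 x) ⁻¹' {z.2}) := by
        intro n
        apply le_dimH_of_hausdorffMeasure_ne_zero (d := (d * (1 - 1 / ((n : ℝ) + 2))).toNNReal)
        rw [Real.coe_toNNReal _ (hpos n).le]
        exact h n
      have ht : Tendsto (fun n : ℕ => ENNReal.ofReal (d * (1 - 1 / ((n : ℝ) + 2)))) atTop
          (𝓝 (ENNReal.ofReal d)) := by
        apply ENNReal.tendsto_ofReal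
        have h0 : Tendsto (fun n : ℕ => 1 / ((n : ℝ) + 2)) atTop (𝓝 0) := by
          have : Tendsto (fun n : ℕ => (n : ℝ) + 2) atTop atTop :=
            tendsto_atTop_add_const_right _ _ tendsto_natCast_atTop_atTop
          exact this.inv_tendsto_atTop.congr fun n => by simp
        have := (h0.const_sub 1).const_mul d
        simpa using this
      exact le_of_tendsto' ht hn
  rw [hEq]
  refine MeasurableSet.iInter fun n => (hnull _ ?_).compl
  have : 1 / ((n : ℝ) + 2) < 1 := by
    rw [div_lt_one (by positivity)]; linarith [Nat.cast_nonneg (α := ℝ) n]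
  exact mul_pos hd (by linarith)

/-- Composition of maps along a word. -/
def wmap {ι Y : Type*} (Φ : ι → Y → Y) : List ι → Y → Y
  | [] => id
  | i :: w => wmap Φ w ∘ Φ i

/-- Product of ratios along a word. -/
def wrat {ι : Type*} (r : ι → ℝ) : List ι → ℝ
  | [] => 1
  | i :: w => wrat r w * r i

theorem wrat_pos {ι : Type*} {r : ι → ℝ} (hr : ∀ i, 0 < r i) (w : List ι) : 0 < wrat r w := by
  induction w with
  | nil => exact one_pos
  | cons i w ih => exact mul_pos ih (hr i)

theorem wmap_dist {ι Y : Type*} [MetricSpace Y] {Φ : ι → Y → Y} {r : ι → ℝ}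
    (h : ∀ i u v, dist (Φ i u) (Φ i v) = r i * dist u v) (w : List ι) (u v : Y) :
    dist (wmap Φ w u) (wmap Φ w v) = wrat r w * dist u v := by
  induction w generalizing u v with
  | nil => simp [wmap, wrat]
  | cons i w ih => simp only [wmap, wrat, Function.comp, ih, h]; ring

theorem word_exists {m : ℕ} {Y : Type*} {Φ : Fin m → Y → Y} {r : Fin m → ℝ}
    (hr : ∀ i, 0 < r i ∧ r i < 1) (hsurj : ∀ x, ∃ i y, Φ i y = x) [Nonempty Y] :
    ∃ κ : ℝ, 0 < κ ∧ κ ≤ 1 ∧ ∀ (x : Y) (t : ℝ), 0 < t → t ≤ 1 →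
      ∃ w z, wmap Φ w z = x ∧ κ * t ≤ wrat r w ∧ wrat r w ≤ t := by
  have hne : Nonempty (Fin m) := ⟨(hsurj (Classical.arbitrary Y)).choose⟩
  obtain ⟨i0, hi0⟩ := Finite.exists_min r
  obtain ⟨i1, hi1⟩ := Finite.exists_max r
  refine ⟨r i0, (hr i0).1, (hr i0).2.le, fun x t ht ht1 => ?_⟩
  have claim : ∀ n : ℕ, ∃ w z, wmap Φ w z = x ∧ r i0 * t ≤ wrat r w ∧
      (wrat r w ≤ t ∨ wrat r w ≤ r i1 ^ n) := by
    intro n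
    induction n with
    | zero =>
      refine ⟨[], x, rfl, ?_, Or.inr (by simp [wrat])⟩
      have := (hr i0).2
      have := (hr i0).1
      simp only [wrat]; nlinarith
    | succ n ih =>
      obtain ⟨w, z, h1, h2, h3⟩ := ih
      by_cases h4 : wrat r w ≤ t
      · exact ⟨w, z, h1, h2, Or.inl h4⟩
      · have h5 := h3.resolve_left h4
        obtain ⟨i, y, hy⟩ := hsurj z
        have hw := wrat_pos (fun i => (hr i).1) w
        refine ⟨i :: w, y, by simp [wmap, hy, h1], ?_, Or.inr ?_⟩
        · simp only [wrat]
          rw [mul_comm]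
          exact mul_le_mul (not_le.1 h4).le (hi0 i) (hr i0).1.le hw.le
        · simp only [wrat]
          rw [pow_succ]
          exact mul_le_mul h5 (hi1 i) (hr i).1.le (by have := (hr i1).1; positivity)
  obtain ⟨n, hn⟩ := exists_pow_lt_of_lt_one ht (hr i1).2
  obtain ⟨w, z, h1, h2, h3⟩ := claim n
  exact ⟨w, z, h1, h2, h3.elim id fun h => h.trans hn.le⟩

section T
variable {p : ℕ} {α : ℝ} {F : Set (Euc p)}

theorem sim_cont {ψ : ↥F → ↥F} {s : ℝ} (hψ : ∀ u v, dist (ψ u) (ψ v) = s * dist u v) :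
    Continuous ψ := by
  have : LipschitzWith (Real.toNNReal s) ψ := LipschitzWith.of_dist_le_mul fun x y => by
    rw [hψ]
    exact mul_le_mul_of_nonneg_right (Real.le_coe_toNNReal s) dist_nonneg
  exact this.continuous

/-- Renormalised restriction to a similar copy. -/
def hbT (ψ : ↥F → ↥F) {s : ℝ} (hs : 0 < s) (hψ : ∀ u v, dist (ψ u) (ψ v) = s * dist u v)
    (q : ℝ) (f : HolderBall p α F) : HolderBall p α F :=
  ⟨(s ^ α)⁻¹ • (f.1.compContinuous ⟨ψ, sim_cont hψ⟩) - BoundedContinuousFunction.const _ q, by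
    intro x y
    change |((s ^ α)⁻¹ * f.1 (ψ x) - q) - ((s ^ α)⁻¹ * f.1 (ψ y) - q)| ≤ _
    have h1 := f.2 (ψ x) (ψ y)
    rw [hψ, Real.mul_rpow hs.le dist_nonneg] at h1
    have hp : 0 < s ^ α := by positivity
    rw [sub_sub_sub_cancel_right, ← mul_sub, abs_mul, abs_of_pos (by positivity),
      inv_mul_le_iff₀ hp]
    exact h1⟩

theorem hbT_apply (ψ : ↥F → ↥F) {s : ℝ} (hs : 0 < s)
    (hψ : ∀ u v, dist (ψ u) (ψ v) = s * dist u v) (q : ℝ) (f : HolderBall p α F) (x : ↥F) :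
    (hbT ψ hs hψ q f).1 x = (s ^ α)⁻¹ * f.1 (ψ x) - q := rfl

theorem hbT_cont (ψ : ↥F → ↥F) {s : ℝ} (hs : 0 < s)
    (hψ : ∀ u v, dist (ψ u) (ψ v) = s * dist u v) (q : ℝ) :
    Continuous (hbT (α := α) ψ hs hψ q) := by
  have hp : 0 < s ^ α := by positivity
  have : LipschitzWith (Real.toNNReal (s ^ α)⁻¹) (hbT (α := α) ψ hs hψ q) :=
    LipschitzWith.of_dist_le_mul fun f g => by
      refine hb_dist_le _ _ (by positivity) fun x => ?_
      rw [hbT_apply, hbT_apply, sub_sub_sub_cancel_right, ← mul_sub, abs_mul,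
        abs_of_pos (by positivity), Real.coe_toNNReal _ (by positivity)]
      exact mul_le_mul_of_nonneg_left (hb_dist f g _) (by positivity)
  exact this.continuous

theorem hbT_open (hα0 : 0 < α) (hα1 : α < 1) (hF : IsCompact F) (hne : F.Nonempty)
    (ψ : ↥F → ↥F) {s : ℝ} (hs : 0 < s)
    (hψ : ∀ u v, dist (ψ u) (ψ v) = s * dist u v) (q : ℝ) :
    IsOpenMap (hbT (α := α) ψ hs hψ q) := by
  have : Nonempty ↥F := hne.to_subtype
  have hp : 0 < s ^ α := by positivity
  rw [isOpenMap_iff_nhds_le]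
  intro f
  rw [((Metric.nhds_basis_ball (x := f)).map _).ge_iff]
  intro η hη
  refine Metric.mem_nhds_iff.2 ⟨η / s ^ α, by positivity, fun h hh => ?_⟩
  rw [mem_ball] at hh
  obtain ⟨f', h1, h2⟩ := hb_ext hα0 hα1 hF ψ (fun x => s ^ α * (h.1 x + q)) (fun x y => by
      have := (abs_le.1 (h.2 x y)).2
      rw [hψ, Real.mul_rpow hs.le dist_nonneg, ← mul_sub, add_sub_add_right_eq_sub]
      exact mul_le_mul_of_nonneg_left this hp.le) f
      (s ^ α * dist h (hbT ψ hs hψ q f)) (fun x => by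
        have h3 := hb_dist h (hbT ψ hs hψ q f) x
        rw [hbT_apply] at h3
        have : s ^ α * (h.1 x + q) - f.1 (ψ x) =
            s ^ α * (h.1 x - ((s ^ α)⁻¹ * f.1 (ψ x) - q)) := by
          field_simp; ring
        rw [this, abs_mul, abs_of_pos hp]
        exact mul_le_mul_of_nonneg_left h3 hp.le)
  refine ⟨f', ?_, ?_⟩
  · rw [mem_ball]
    refine (hb_dist_le f' f (by positivity) h2).trans_lt ?_
    rwa [lt_div_iff₀' hp] at hh
  · apply Subtype.ext
    ext x
    change (s ^ α)⁻¹ * f'.1 (ψ x) - q = h.1 x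
    rw [h1]
    field_simp
    ring

end T

/-- Extracting a separated net from a finite set. -/
theorem sep_net {Y : Type*} [MetricSpace Y] (R : ℝ) (hR : 0 < R) (N : Set Y) (hN : N.Finite) :
    ∃ S ⊆ N, (∀ x ∈ S, ∀ y ∈ S, x ≠ y → R ≤ dist x y) ∧ ∀ x ∈ N, ∃ y ∈ S, dist x y < R := by
  induction N, hN using Set.Finite.induction_on with
  | empty => exact ⟨∅, subset_rfl, by simp, by simp⟩
  | @insert a N _ _ ih =>
    obtain ⟨S, hS, h1, h2⟩ := ih
    by_cases h : ∃ y ∈ S, dist a y < R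
    · refine ⟨S, hS.trans (subset_insert _ _), h1, ?_⟩
      rintro x (rfl | hx)
      · exact h
      · exact h2 x hx
    · push Not at h
      refine ⟨insert a S, insert_subset_insert hS, ?_, ?_⟩
      · rintro x (rfl | hx) y (rfl | hy) hxy
        · exact absurd rfl hxy
        · exact h y hy
        · rw [dist_comm]; exact h x hx
        · exact h1 x hx y hy hxy
      · rintro x (rfl | hx)
        · exact ⟨x, mem_insert _ _, by simpa using hR⟩
        · obtain ⟨y, hy, hxy⟩ := h2 x hx
          exact ⟨y, mem_insert_of_mem _ hy, hxy⟩

theorem sep_net' {Y : Type*} [MetricSpace Y] [CompactSpace Y] (R : ℝ) (hR : 0 < R) :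
    ∃ S : Set Y, S.Finite ∧ (∀ x ∈ S, ∀ y ∈ S, x ≠ y → R ≤ dist x y) ∧
      ∀ x, ∃ y ∈ S, dist x y < 2 * R := by
  obtain ⟨N, -, hN, hc⟩ := (isCompact_univ (X := Y)).finite_cover_balls hR
  obtain ⟨S, hS, h1, h2⟩ := sep_net R hR N hN
  refine ⟨S, hN.subset hS, h1, fun x => ?_⟩
  obtain ⟨z, hz, hxz⟩ := mem_iUnion₂.1 (hc (mem_univ x))
  obtain ⟨y, hy, hzy⟩ := h2 z hz
  rw [mem_ball] at hxz
  exact ⟨y, hy, by linarith [dist_triangle x z y]⟩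

open scoped ENNReal NNReal Topology

theorem choose_t {α : ℝ} (hα0 : 0 < α) (hα1 : α < 1) {τ δ A B : ℝ} (hτ : 0 < τ) (hδ : 0 < δ) :
    ∃ t : ℝ, 0 < t ∧ t ≤ 1 ∧ t ≤ τ ∧ A * t ^ α < δ ∧ B * t ≤ t ^ α := by
  have h0 : ∀ β : ℝ, 0 < β → ∀ D : ℝ, Tendsto (fun t : ℝ => D * t ^ β) (𝓝[>] 0) (𝓝 0) := by
    intro β hβ D
    have : Continuous fun t : ℝ => D * t ^ β :=
      continuous_const.mul (Real.continuous_rpow_const hβ.le)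
    have := this.tendsto 0
    rw [Real.zero_rpow hβ.ne', mul_zero] at this
    exact this.mono_left nhdsWithin_le_nhds
  have e1 := (h0 α hα0 A).eventually (gt_mem_nhds hδ)
  have e2 := (h0 (1 - α) (by linarith) B).eventually (gt_mem_nhds one_pos)
  have e3 : ∀ᶠ t : ℝ in 𝓝[>] 0, t < min 1 τ :=
    nhdsWithin_le_nhds (gt_mem_nhds (lt_min one_pos hτ))
  have e4 : ∀ᶠ t : ℝ in 𝓝[>] 0, 0 < t := self_mem_nhdsWithin
  obtain ⟨t, h1, h2, h3, h4⟩ := (e1.and (e2.and (e3.and e4))).exists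
  refine ⟨t, h4, (h3.trans_le (min_le_left _ _)).le, (h3.trans_le (min_le_right _ _)).le, h1, ?_⟩
  have : t = t ^ (1 - α) * t ^ α := by
    rw [← Real.rpow_add h4]; simp
  have hp : 0 < t ^ α := by positivity
  calc B * t = (B * t ^ (1 - α)) * t ^ α := by rw [mul_assoc, ← this]
    _ ≤ 1 * t ^ α := by gcongr
    _ = _ := one_mul _

section key
variable {p m : ℕ} {α : ℝ} {F : Set (Euc p)} {Φ : Fin m → ↥F → ↥F} {r : Fin m → ℝ}

/-- The renormalised restriction along a word, shifted by a rational. -/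
def wT (α : ℝ) (hr : ∀ i, 0 < r i ∧ r i < 1)
    (hsim : ∀ i u v, dist (Φ i u) (Φ i v) = r i * dist u v) (c : List (Fin m) × ℚ)
    (f : HolderBall p α F) : HolderBall p α F :=
  hbT (wmap Φ c.1) (wrat_pos (fun i => (hr i).1) c.1) (wmap_dist hsim c.1) (c.2 : ℝ) f

theorem key_constr (hα0 : 0 < α) (hα1 : α < 1) (hF : IsCompact F) (hne : F.Nonempty)
    (hd1 : ∀ x y : ↥F, dist x y ≤ 1)
    (hr : ∀ i, 0 < r i ∧ r i < 1)
    (hsim : ∀ i u v, dist (Φ i u) (Φ i v) = r i * dist u v)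
    (hsurj : ∀ x, ∃ i y, Φ i y = x) (f₀ : HolderBall p α F) :
    ∃ K : ℝ, 0 < K ∧ ∀ (g : HolderBall p α F) (δ τ : ℝ), 0 < δ → 0 < τ →
      ∃ f : HolderBall p α F, dist f g < δ ∧ ∃ S : Set (List (Fin m) × ℚ), S.Finite ∧
        (∀ c ∈ S, wrat r c.1 ≤ τ ∧ wT α hr hsim c f = f₀) ∧
        ∀ x, ∃ c ∈ S, ∃ z, |f.1 x - f.1 (wmap Φ c.1 z)| ≤ K * wrat r c.1 ^ α := by
  have : Nonempty ↥F := hne.to_subtype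
  have : CompactSpace ↥F := isCompact_iff_compactSpace.1 hF
  obtain ⟨κ, hκ0, hκ1, hκ⟩ := word_exists hr hsurj
  have hM : 0 ≤ ‖f₀.1‖ := norm_nonneg _
  have hMf : ∀ x, |f₀.1 x| ≤ ‖f₀.1‖ := fun x => f₀.1.norm_coe_le_norm x
  set M := ‖f₀.1‖
  refine ⟨(2 * M + 5) * (κ ^ α)⁻¹, by positivity, fun g δ τ hδ hτ => ?_⟩
  obtain ⟨g₁, hg₁, θ, hθ, L, hL, gH, gL⟩ := hb_smooth hα0 hα1 hF hne g (half_pos hδ)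
  set C := 2 + (2 * (M + 2) / θ) ^ (1 / α) with hC
  have hC2 : 2 < C := by
    have : 0 < (2 * (M + 2) / θ) ^ (1 / α) := by positivity
    linarith
  have hCα : θ * (C - 2) ^ α = 2 * (M + 2) := by
    rw [hC, add_sub_cancel_left, ← Real.rpow_mul (by positivity), one_div,
      inv_mul_cancel₀ hα0.ne', Real.rpow_one]
    field_simp
  obtain ⟨t, ht0, ht1, htτ, htA, htB⟩ :=
    choose_t (A := M + 2) (B := 2 * (L * C)) hα0 hα1 hτ (half_pos hδ)
  obtain ⟨S, hSfin, hSsep, hScov⟩ := sep_net' (Y := ↥F) (C * t) (by positivity)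
  have hSne : Nonempty S := by
    obtain ⟨y, hy, -⟩ := hScov (Classical.arbitrary _)
    exact ⟨⟨y, hy⟩⟩
  choose W Z hWZ hW1 hW2 using fun x : ↥F => hκ x t ht0 ht1
  have hWp : ∀ x, 0 < wrat r (W x) := fun x => wrat_pos (fun i => (hr i).1) _
  have hρα : ∀ x, wrat r (W x) ^ α ≤ t ^ α := fun x =>
    Real.rpow_le_rpow (hWp x).le (hW2 x) hα0.le
  have htα : 0 < t ^ α := by positivity
  have hq : ∀ x : ↥F, ∃ q : ℚ, |wrat r (W x) ^ α * q - g₁.1 x| ≤ t ^ α := by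
    intro x
    have hp : 0 < wrat r (W x) ^ α := Real.rpow_pos_of_pos (hWp x) _
    obtain ⟨q, h1, h2⟩ := exists_rat_btwn
      (show g₁.1 x / wrat r (W x) ^ α < g₁.1 x / wrat r (W x) ^ α + 1 by linarith)
    refine ⟨q, ?_⟩
    rw [div_lt_iff₀' hp] at h1
    rw [← sub_lt_iff_lt_add, lt_div_iff₀' hp] at h2
    have := hρα x
    exact abs_le.2 ⟨by linarith, by linarith⟩
  choose q hq using hq
  let a : S × ↥F → ↥F := fun j => wmap Φ (W j.1) j.2
  let h : S × ↥F → ℝ := fun j => wrat r (W j.1) ^ α * (f₀.1 j.2 + q j.1)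
  have hax : ∀ j : S × ↥F, dist (a j) j.1 ≤ t := by
    intro j
    have h1 := wmap_dist hsim (W j.1) j.2 (Z j.1)
    rw [hWZ] at h1
    change dist (wmap Φ (W j.1) j.2) (j.1 : ↥F) ≤ t
    rw [h1]
    calc wrat r (W j.1) * dist j.2 (Z j.1) ≤ t * 1 :=
          mul_le_mul (hW2 _) (hd1 _ _) dist_nonneg ht0.le
      _ = t := mul_one t
  have hclose : ∀ j, |h j - g₁.1 (a j)| ≤ (M + 2) * t ^ α := by
    intro j
    have h1 := abs_le.1 (hq j.1)
    have h2 : |wrat r (W j.1) ^ α * f₀.1 j.2| ≤ t ^ α * M := by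
      rw [abs_mul, abs_of_pos (Real.rpow_pos_of_pos (hWp _) _)]
      exact mul_le_mul (hρα _) (hMf _) (abs_nonneg _) htα.le
    have h2 := abs_le.1 h2
    have h3 : |g₁.1 (a j) - g₁.1 j.1| ≤ t ^ α :=
      (g₁.2 _ _).trans (Real.rpow_le_rpow dist_nonneg (hax j) hα0.le)
    have h3 := abs_le.1 h3
    have h4 : h j = wrat r (W j.1) ^ α * f₀.1 j.2 + wrat r (W j.1) ^ α * q j.1 := by
      simp only [h]; ring
    rw [h4]
    exact abs_le.2 ⟨by linarith, by linarith⟩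
  have hH : ∀ i j, h i - h j ≤ dist (a i) (a j) ^ α := by
    rintro ⟨x, u⟩ ⟨y, v⟩
    by_cases hxy : x = y
    · subst hxy
      have h1 := (abs_le.1 (f₀.2 u v)).2
      have hp : 0 < wrat r (W x) ^ α := Real.rpow_pos_of_pos (hWp x) _
      change wrat r (W x) ^ α * (f₀.1 u + q x) - wrat r (W x) ^ α * (f₀.1 v + q x) ≤
        dist (wmap Φ (W x) u) (wmap Φ (W x) v) ^ α
      rw [wmap_dist hsim, Real.mul_rpow (hWp x).le dist_nonneg, ← mul_sub,
        add_sub_add_right_eq_sub]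
      exact mul_le_mul_of_nonneg_left h1 hp.le
    · have hne : (x : ↥F) ≠ y := fun h => hxy (Subtype.ext h)
      have h1 := hSsep x x.2 y y.2 hne
      have h2 := hax (x, u)
      have h3 := hax (y, v)
      have h4 : (C - 2) * t ≤ dist (a (x, u)) (a (y, v)) := by
        have h5 := dist_triangle4 (x : ↥F) (a (x, u)) (a (y, v)) y
        rw [dist_comm (x : ↥F) (a (x, u))] at h5
        simp only at h2 h3
        linarith
      have h5 : 2 * (M + 2) * t ^ α ≤ θ * dist (a (x, u)) (a (y, v)) ^ α := by
        have := Real.rpow_le_rpow (mul_nonneg (by linarith) ht0.le) h4 hα0.le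
        rw [Real.mul_rpow (by linarith) ht0.le] at this
        rw [← hCα, mul_assoc]
        exact mul_le_mul_of_nonneg_left this hθ.le
      have h6 := abs_le.1 (hclose (x, u))
      have h7 := abs_le.1 (hclose (y, v))
      have h8 := (abs_le.1 (gH (a (x, u)) (a (y, v)))).2
      linarith
  obtain ⟨f, hf1, hf2⟩ := hb_ext hα0 hα1 hF a h hH g₁ _ hclose
  refine ⟨f, ?_, (fun x : ↥F => (W x, q x)) '' S, hSfin.image _, ?_, ?_⟩
  · have := hb_dist_le f g₁ (by positivity) hf2
    linarith [dist_triangle f g₁ g]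
  · rintro _ ⟨x, hx, rfl⟩
    refine ⟨(hW2 x).trans htτ, ?_⟩
    apply Subtype.ext
    ext u
    have h1 := hf1 (⟨x, hx⟩, u)
    have hp : 0 < wrat r (W x) ^ α := Real.rpow_pos_of_pos (hWp x) _
    change (wrat r (W x) ^ α)⁻¹ * f.1 (wmap Φ (W x) u) - q x = f₀.1 u
    change f.1 (wmap Φ (W x) u) = wrat r (W x) ^ α * (f₀.1 u + q x) at h1
    rw [h1]
    field_simp
    ring
  · intro x
    obtain ⟨y, hy, hxy⟩ := hScov x
    refine ⟨_, ⟨y, hy, rfl⟩, Z y, ?_⟩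
    simp only [hWZ]
    have h1 := abs_le.1 (hf2 x)
    have h2 := abs_le.1 (hf2 y)
    have h3 := abs_le.1 (gL x y)
    have h4 : L * dist x y ≤ t ^ α := by
      refine le_trans ?_ htB
      calc L * dist x y ≤ L * (2 * (C * t)) := by gcongr
        _ = _ := by ring
    have h5 : κ ^ α * t ^ α ≤ wrat r (W y) ^ α := by
      rw [← Real.mul_rpow hκ0.le ht0.le]
      exact Real.rpow_le_rpow (by positivity) (hW1 y) hα0.le
    have hκα : 0 < κ ^ α := by positivity
    have h6 : (2 * M + 5) * t ^ α ≤ (2 * M + 5) * (κ ^ α)⁻¹ * wrat r (W y) ^ α := by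
      rw [mul_assoc]
      refine mul_le_mul_of_nonneg_left ?_ (by positivity)
      rwa [le_inv_mul_iff₀ hκα]
    refine le_trans ?_ h6
    exact abs_le.2 ⟨by linarith, by linarith⟩

end key

open scoped ENNReal NNReal Topology Pointwise

section dich
variable {p m : ℕ} {α : ℝ} {F : Set (Euc p)} {Φ : Fin m → ↥F → ↥F} {r : Fin m → ℝ}

/-- The set of levels with large level set. -/
def lev (d : ℝ) (f : HolderBall p α F) : Set ℝ :=
  {y | ENNReal.ofReal d ≤ dimH ((fun x : ↥F => f.1 x) ⁻¹' {y})}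

theorem lev_meas (hF : IsCompact F) {d : ℝ} (hd : 0 < d) (f : HolderBall p α F) :
    MeasurableSet (lev d f) :=
  measurable_prodMk_left (x := f) (bigE_meas p α F hF hd)

theorem lev_vol_meas (hF : IsCompact F) {d : ℝ} (hd : 0 < d) :
    Measurable fun f : HolderBall p α F => volume (lev d f) :=
  measurable_measure_prodMk_left (ν := (volume : Measure ℝ)) (bigE_meas p α F hF hd)

theorem vol_affine (a q : ℝ) (A : Set ℝ) :
    volume ((fun y => a * (y + q)) '' A) = ENNReal.ofReal |a| * volume A := by
  have : (fun y => a * (y + q)) '' A = a • ((fun y => y + q) '' A) := by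
    rw [← image_smul, image_image]; rfl
  rw [this, Measure.addHaar_smul]
  simp

theorem lev_scale (hα0 : 0 < α) (hd1 : ∀ x y : ↥F, dist x y ≤ 1)
    (hr : ∀ i, 0 < r i ∧ r i < 1)
    (hsim : ∀ i u v, dist (Φ i u) (Φ i v) = r i * dist u v) {d : ℝ} (hd : 0 < d)
    (c : List (Fin m) × ℚ) (f : HolderBall p α F) (z : ↥F) :
    ENNReal.ofReal (wrat r c.1 ^ α) * volume (lev d (wT α hr hsim c f)) ≤
      volume (lev d f ∩ closedBall (f.1 (wmap Φ c.1 z)) (wrat r c.1 ^ α)) := by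
  have hρ := wrat_pos (fun i => (hr i).1) c.1
  set ρ := wrat r c.1 with hρdef
  have hp : 0 < ρ ^ α := Real.rpow_pos_of_pos hρ _
  have h := vol_affine (ρ ^ α) c.2 (lev d (wT α hr hsim c f))
  rw [abs_of_pos hp] at h
  rw [← h]
  apply measure_mono
  rintro _ ⟨y, hy, rfl⟩
  have hy' : ENNReal.ofReal d ≤ dimH ((fun x : ↥F => (wT α hr hsim c f).1 x) ⁻¹' {y}) := hy
  have happ : ∀ u, (wT α hr hsim c f).1 u = (ρ ^ α)⁻¹ * f.1 (wmap Φ c.1 u) - c.2 := fun u => rfl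
  have hval : ∀ u, (wT α hr hsim c f).1 u = y → f.1 (wmap Φ c.1 u) = ρ ^ α * (y + c.2) := by
    intro u hu
    rw [← hu, happ]
    field_simp
    ring
  constructor
  · change ENNReal.ofReal d ≤ dimH ((fun x : ↥F => f.1 x) ⁻¹' {ρ ^ α * (y + c.2)})
    have hanti : AntilipschitzWith (Real.toNNReal ρ⁻¹) (wmap Φ c.1) :=
      AntilipschitzWith.of_le_mul_dist fun u v => by
        rw [wmap_dist hsim, Real.coe_toNNReal _ (by positivity), ← mul_assoc, ← hρdef,
          inv_mul_cancel₀ hρ.ne', one_mul]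
    refine hy'.trans ((hanti.le_dimH_image _).trans (dimH_mono ?_))
    rintro _ ⟨u, hu, rfl⟩
    exact hval u hu
  · obtain ⟨u, hu⟩ : ((fun x : ↥F => (wT α hr hsim c f).1 x) ⁻¹' {y}).Nonempty := by
      by_contra hne
      rw [not_nonempty_iff_eq_empty] at hne
      rw [hne, dimH_empty] at hy'
      simp at hy'
      linarith
    change ρ ^ α * (y + c.2) ∈ _
    rw [mem_closedBall, Real.dist_eq, ← hval u hu]
    refine (f.2 _ _).trans (Real.rpow_le_rpow dist_nonneg ?_ hα0.le)
    rw [wmap_dist hsim]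
    have := hd1 u z
    nlinarith

theorem density_arg {E : Set ℝ} (hE : MeasurableSet E) {Y : Set ℝ} {c K : ℝ} (hc : 0 < c)
    (hK : 0 < K)
    (h : ∀ y ∈ Y, ∀ N : ℕ, ∃ R : ℝ, 0 < R ∧ R ≤ 1 / ((N : ℝ) + 1) ∧
      ENNReal.ofReal (c * R) ≤ volume (E ∩ closedBall y (K * R))) :
    volume (Y \ E) = 0 := by
  have hae := Besicovitch.ae_tendsto_measure_inter_div_of_measurableSet volume hE
  rw [← nonpos_iff_eq_zero]
  refine le_trans (measure_mono ?_) (le_of_eq (ae_iff.1 hae))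
  rintro y ⟨hyY, hyE⟩ ht
  rw [indicator_of_notMem hyE] at ht
  choose R hR0 hR1 hR using h y hyY
  have hRt : Tendsto R atTop (𝓝 0) :=
    squeeze_zero (fun n => (hR0 n).le) hR1 tendsto_one_div_add_atTop_nhds_zero_nat
  have hKR : Tendsto (fun n => K * R n) atTop (𝓝[>] 0) := by
    refine tendsto_nhdsWithin_iff.2 ⟨by simpa using hRt.const_mul K, ?_⟩
    exact Eventually.of_forall fun n => mul_pos hK (hR0 n)
  have hcomp := ht.comp hKR
  have hpos : (0 : ℝ≥0∞) < ENNReal.ofReal (c / (2 * K)) := ENNReal.ofReal_pos.2 (by positivity)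
  obtain ⟨n, hn⟩ := (hcomp.eventually (gt_mem_nhds hpos)).exists
  refine absurd hn (not_lt.2 ?_)
  have hRn := hR0 n
  simp only [Function.comp, Real.volume_closedBall]
  rw [ENNReal.le_div_iff_mul_le (Or.inl (ENNReal.ofReal_pos.2 (by positivity)).ne')
      (Or.inl ENNReal.ofReal_ne_top),
    ← ENNReal.ofReal_mul (by positivity)]
  convert hR n using 2
  field_simp

theorem dichotomy (hα0 : 0 < α) (hα1 : α < 1) (hF : IsCompact F) (hne : F.Nonempty)
    (hd1 : ∀ x y : ↥F, dist x y ≤ 1)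
    (hr : ∀ i, 0 < r i ∧ r i < 1)
    (hsim : ∀ i u v, dist (Φ i u) (Φ i v) = r i * dist u v)
    (hsurj : ∀ x, ∃ i y, Φ i y = x) {d : ℝ} (hd : 0 < d) :
    (∀ᶠ f in residual (HolderBall p α F), volume (lev d f) = 0) ∨
    (∀ᶠ f in residual (HolderBall p α F), 0 < volume (lev d f) ∧
      volume (range (fun x : ↥F => f.1 x) \ lev d f) = 0) := by
  by_cases hfirst : ∀ n : ℕ, ∀ᶠ f in residual (HolderBall p α F),
      volume (lev d f) ≤ ENNReal.ofReal (1 / ((n : ℝ) + 1))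
  · left
    filter_upwards [eventually_countable_forall.2 hfirst] with f hf
    have ht : Tendsto (fun n : ℕ => ENNReal.ofReal (1 / ((n : ℝ) + 1))) atTop (𝓝 0) := by
      simpa using ENNReal.tendsto_ofReal tendsto_one_div_add_atTop_nhds_zero_nat
    exact le_antisymm (ge_of_tendsto' ht hf) bot_le
  right
  push Not at hfirst
  obtain ⟨n, hn⟩ := hfirst
  set c : ℝ := 1 / ((n : ℝ) + 1) with hcdef
  have hc : 0 < c := by positivity
  have hSm : MeasurableSet {f : HolderBall p α F | ENNReal.ofReal c < volume (lev d f)} :=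
    measurableSet_lt measurable_const (lev_vol_meas hF hd)
  obtain ⟨U, hU, hSU⟩ := hSm.residualEq_isOpen
  have hSU' : ∀ᶠ f in residual (HolderBall p α F),
      (ENNReal.ofReal c < volume (lev d f) ↔ f ∈ U) := hSU.mem_iff
  obtain ⟨f₀, hf₀⟩ : U.Nonempty := by
    by_contra hemp
    rw [not_nonempty_iff_eq_empty] at hemp
    apply hn
    filter_upwards [hSU'] with f hf
    by_contra hlt
    have := hf.1 (by simpa using hlt)
    rw [hemp] at this
    exact this
  obtain ⟨K, hK, hkey⟩ := key_constr hα0 hα1 hF hne hd1 hr hsim hsurj f₀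
  have h2 : ∀ᶠ f in residual (HolderBall p α F), ∀ w : List (Fin m) × ℚ,
      wT α hr hsim w f ∈ U → ENNReal.ofReal c < volume (lev d (wT α hr hsim w f)) := by
    refine eventually_countable_forall.2 fun w => ?_
    have ht : Tendsto (wT α hr hsim w) (residual (HolderBall p α F)) (residual _) :=
      tendsto_residual_of_isOpenMap (hbT_cont (wmap Φ w.1) (wrat_pos (fun i => (hr i).1) w.1) (wmap_dist hsim w.1) (w.2 : ℝ)) (hbT_open hα0 hα1 hF hne (wmap Φ w.1) (wrat_pos (fun i => (hr i).1) w.1) (wmap_dist hsim w.1) (w.2 : ℝ))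
    filter_upwards [ht.eventually hSU'] with f hf using hf.2
  let O : ℕ → Set (HolderBall p α F) := fun N => {f | ∀ x, ∃ w : List (Fin m) × ℚ, ∃ z,
    wrat r w.1 ^ α ≤ 1 / ((N : ℝ) + 1) ∧ wT α hr hsim w f ∈ U ∧
      |f.1 x - f.1 (wmap Φ w.1 z)| ≤ (K + 1) * wrat r w.1 ^ α}
  have h3 : ∀ N, ∀ᶠ f in residual (HolderBall p α F), f ∈ O N := by
    intro N
    have hdense : Dense (interior (O N)) := by
      rw [Metric.dense_iff]
      intro g δ hδ
      obtain ⟨f, hfg, S, hS, hS1, hS2⟩ :=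
        hkey g δ ((1 / ((N : ℝ) + 1)) ^ (1 / α)) hδ (by positivity)
      refine ⟨f, hfg, ?_⟩
      rw [mem_interior_iff_mem_nhds]
      have e1 : ∀ᶠ f' in 𝓝 f, ∀ w ∈ S, wT α hr hsim w f' ∈ U ∧
          dist f' f < wrat r w.1 ^ α / 2 := by
        refine (Set.Finite.eventually_all hS).2 fun w hw => ?_
        have hp : 0 < wrat r w.1 ^ α :=
          Real.rpow_pos_of_pos (wrat_pos (fun i => (hr i).1) _) _
        have hcT : Continuous (wT (p := p) (F := F) α hr hsim w) := hbT_cont (wmap Φ w.1) (wrat_pos (fun i => (hr i).1) w.1) (wmap_dist hsim w.1) (w.2 : ℝ)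
        refine (hcT.continuousAt.eventually (hU.mem_nhds ?_)).and
          (Metric.ball_mem_nhds f (by positivity))
        rw [(hS1 w hw).2]; exact hf₀
      filter_upwards [e1] with f' hf' x
      obtain ⟨w, hw, z, hz⟩ := hS2 x
      refine ⟨w, z, ?_, (hf' w hw).1, ?_⟩
      · have := Real.rpow_le_rpow (wrat_pos (fun i => (hr i).1) w.1).le (hS1 w hw).1 hα0.le
        rwa [← Real.rpow_mul (by positivity), one_div α, inv_mul_cancel₀ hα0.ne',
          Real.rpow_one] at this
      · have a1 := abs_le.1 (hb_dist f' f x)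
        have a2 := abs_le.1 (hb_dist f' f (wmap Φ w.1 z))
        have a3 := abs_le.1 hz
        have a4 := (hf' w hw).2
        exact abs_le.2 ⟨by linarith, by linarith⟩
    exact mem_of_superset (residual_of_dense_open isOpen_interior hdense) interior_subset
  filter_upwards [h2, eventually_countable_forall.2 h3] with f hf2 hf3
  have main : ∀ y ∈ range (fun x : ↥F => f.1 x), ∀ N : ℕ, ∃ R : ℝ, 0 < R ∧
      R ≤ 1 / ((N : ℝ) + 1) ∧
      ENNReal.ofReal (c * R) ≤ volume (lev d f ∩ closedBall y ((K + 2) * R)) := by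
    rintro _ ⟨x, rfl⟩ N
    obtain ⟨w, z, h4, h5, h6⟩ := hf3 N x
    have hp : 0 < wrat r w.1 ^ α :=
      Real.rpow_pos_of_pos (wrat_pos (fun i => (hr i).1) _) _
    refine ⟨wrat r w.1 ^ α, hp, h4, ?_⟩
    rw [mul_comm c, ENNReal.ofReal_mul hp.le]
    refine (mul_le_mul_right (hf2 w h5).le _).trans ((lev_scale hα0 hd1 hr hsim hd w f z).trans ?_)
    refine measure_mono (inter_subset_inter_right _ (closedBall_subset_closedBall' ?_))
    rw [Real.dist_eq, abs_sub_comm]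
    linarith
  refine ⟨?_, density_arg (lev_meas hF hd f) hc (by linarith) main⟩
  obtain ⟨x, hx⟩ := hne
  obtain ⟨R, h4, h5, h6⟩ := main _ ⟨⟨x, hx⟩, rfl⟩ 0
  exact (ENNReal.ofReal_pos.2 (mul_pos hc h4)).trans_le (h6.trans (measure_mono inter_subset_left))

end dich

open scoped ENNReal NNReal Topology

theorem hb_complete (p : ℕ) (α : ℝ) (F : Set (Euc p)) : CompleteSpace (HolderBall p α F) := by
  have hcl : IsClosed {f : BoundedContinuousFunction ↥F ℝ |
      ∀ x y : ↥F, |f x - f y| ≤ dist x y ^ α} := by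
    simp only [ofPred_forall]
    refine isClosed_iInter fun x => isClosed_iInter fun y => ?_
    refine isClosed_le ?_ continuous_const
    exact ((continuous_eval_const x).sub (continuous_eval_const y)).abs
  exact hcl.completeSpace_coe

theorem lev_anti {p : ℕ} {α : ℝ} {F : Set (Euc p)} {d d' : ℝ} (h : d ≤ d')
    (f : HolderBall p α F) : lev d' f ⊆ lev d f := fun _ hy =>
  (ENNReal.ofReal_le_ofReal h).trans hy

theorem dimH_le_p {p : ℕ} {F : Set (Euc p)} (s : Set ↥F) : dimH s ≤ (p : ℝ≥0∞) := by
  rw [← (isometry_subtype_coe (s := F)).dimH_image s]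
  refine (dimH_mono (subset_univ _)).trans ?_
  rw [Real.dimH_univ_eq_finrank]
  simp

theorem lev_empty {p : ℕ} {α : ℝ} {F : Set (Euc p)} {d : ℝ} (h : (p : ℝ) < d)
    (f : HolderBall p α F) : lev d f = ∅ := by
  rw [eq_empty_iff_forall_notMem]
  intro y hy
  have hy' : ENNReal.ofReal d ≤ dimH ((fun x : ↥F => f.1 x) ⁻¹' {y}) := hy
  have := hy'.trans (dimH_le_p _)
  rw [← ENNReal.ofReal_natCast, ENNReal.ofReal_le_ofReal_iff (by positivity)] at this
  linarith

theorem lev_nonpos {p : ℕ} {α : ℝ} {F : Set (Euc p)} {d : ℝ} (h : d ≤ 0)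
    (f : HolderBall p α F) : lev d f = univ := by
  rw [eq_univ_iff_forall]
  intro y
  change ENNReal.ofReal d ≤ _
  rw [ENNReal.ofReal_of_nonpos h]
  exact bot_le

theorem DstarOn_eq {p : ℕ} {α : ℝ} {F : Set (Euc p)} (f : HolderBall p α F) :
    DstarOn (fun x : ↥F => f.1 x) Set.univ = sSup {d : ℝ | 0 < volume (lev d f)} := by
  unfold DstarOn lev
  simp only [inter_univ]

theorem main_abs {p m : ℕ} {α : ℝ} {F : Set (Euc p)} {Φ : Fin m → ↥F → ↥F} {r : Fin m → ℝ}
    (hα0 : 0 < α) (hα1 : α < 1) (hF : IsCompact F) (hne : F.Nonempty)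
    (hd1 : ∀ x y : ↥F, dist x y ≤ 1)
    (hr : ∀ i, 0 < r i ∧ r i < 1)
    (hsim : ∀ i u v, dist (Φ i u) (Φ i v) = r i * dist u v)
    (hsurj : ∀ x, ∃ i y, Φ i y = x) :
    ∃ G : Set (HolderBall p α F), Dense G ∧ IsGδ G ∧
      ∀ f ∈ G,
        ∀ᵐ y ∂(volume.restrict (Set.range (fun x : ↥F => f.1 x))),
          dimH ((fun x : ↥F => f.1 x) ⁻¹' {y}) = ENNReal.ofReal (DstarAlpha p α F) := by
  have : CompleteSpace (HolderBall p α F) := hb_complete p α F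
  have : Nonempty (HolderBall p α F) :=
    ⟨⟨0, fun x y => by simp; positivity⟩⟩
  have hBaire : (residual (HolderBall p α F)).NeBot := by
    refine ⟨fun hbot => ?_⟩
    have h0 : (∅ : Set (HolderBall p α F)) ∈ residual (HolderBall p α F) := by
      rw [hbot]; exact mem_bot
    exact (dense_of_mem_residual h0).nonempty.ne_empty rfl
  let Q : ℝ → HolderBall p α F → Prop := fun d f =>
    0 < volume (lev d f) ∧ volume (range (fun x : ↥F => f.1 x) \ lev d f) = 0
  have hdich : ∀ d, 0 < d → (∀ᶠ f in residual (HolderBall p α F), volume (lev d f) = 0) ∨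
      ∀ᶠ f in residual (HolderBall p α F), Q d f := fun d hd =>
    dichotomy hα0 hα1 hF hne hd1 hr hsim hsurj hd
  have hQ0 : ∀ d ≤ 0, ∀ f, Q d f := fun d hd f => by
    simp only [Q, lev_nonpos hd]
    simp
  set Z : Set ℝ := {d | ∀ᶠ f in residual (HolderBall p α F), Q d f} with hZ
  have hZ0 : (0 : ℝ) ∈ Z := by
    change ∀ᶠ f in residual (HolderBall p α F), Q 0 f
    exact Eventually.of_forall (hQ0 0 le_rfl)
  have hZb : BddAbove Z := by
    refine ⟨p, fun d hd => ?_⟩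
    by_contra hlt
    obtain ⟨f, hf⟩ := Eventually.exists (f := residual (HolderBall p α F)) hd
    have := hf.1
    rw [lev_empty (not_le.1 hlt)] at this
    simp at this
  set D := sSup Z with hD
  have hD0 : 0 ≤ D := le_csSup hZb hZ0
  have hup : ∀ n : ℕ, ∀ᶠ f in residual (HolderBall p α F),
      volume (lev (D + 1 / ((n : ℝ) + 1)) f) = 0 := by
    intro n
    have hpos : 0 < 1 / ((n : ℝ) + 1) := by positivity
    refine (hdich _ (by linarith)).resolve_right fun h => ?_
    have := le_csSup hZb h
    linarith
  have hlow : ∀ n : ℕ, ∀ᶠ f in residual (HolderBall p α F), Q (D - 1 / ((n : ℝ) + 1)) f := by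
    intro n
    have hpos : 0 < 1 / ((n : ℝ) + 1) := by positivity
    obtain ⟨d, hd, hlt⟩ := exists_lt_of_lt_csSup ⟨0, hZ0⟩
      (show D - 1 / ((n : ℝ) + 1) < sSup Z by linarith)
    have hd' : ∀ᶠ f in residual (HolderBall p α F), Q d f := hd
    filter_upwards [hd'] with f hf
    have hsub := lev_anti hlt.le f
    refine ⟨hf.1.trans_le (measure_mono hsub), ?_⟩
    exact measure_mono_null (sdiff_subset_sdiff_right hsub) hf.2
  have hev := (eventually_countable_forall.2 hup).and (eventually_countable_forall.2 hlow)
  obtain ⟨G, hGsub, hGδ, hGd⟩ := mem_residual.1 hev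
  have ht : Tendsto (fun n : ℕ => 1 / ((n : ℝ) + 1)) atTop (𝓝 0) :=
    tendsto_one_div_add_atTop_nhds_zero_nat
  -- the value of `D_*^f` on `G`
  have hval : ∀ f ∈ G, DstarOn (fun x : ↥F => f.1 x) Set.univ = D := by
    intro f hf
    obtain ⟨h1, h2⟩ := hGsub hf
    rw [DstarOn_eq]
    have hub : ∀ d ∈ {d : ℝ | 0 < volume (lev d f)}, d ≤ D := by
      intro d hd
      have hd' : 0 < volume (lev d f) := hd
      by_contra hlt
      obtain ⟨n, hn⟩ := exists_nat_one_div_lt (show 0 < d - D by linarith [not_le.1 hlt])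
      have := measure_mono_null (lev_anti (show D + 1 / ((n : ℝ) + 1) ≤ d by linarith) f) (h1 n)
      rw [this] at hd'
      exact lt_irrefl _ hd'
    apply le_antisymm
    · exact csSup_le ⟨_, (h2 0).1⟩ hub
    · have h3 : ∀ n : ℕ, D - 1 / ((n : ℝ) + 1) ≤ sSup {d : ℝ | 0 < volume (lev d f)} :=
        fun n => le_csSup ⟨D, hub⟩ (h2 n).1
      have h4 : Tendsto (fun n : ℕ => D - 1 / ((n : ℝ) + 1)) atTop (𝓝 D) := by
        simpa using ht.const_sub D
      exact le_of_tendsto' h4 h3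
  have hnn : ∀ f : HolderBall p α F, 0 ≤ DstarOn (fun x : ↥F => f.1 x) Set.univ := by
    intro f
    rw [DstarOn_eq]
    refine le_csSup ⟨p, fun d hd => ?_⟩ (hQ0 0 le_rfl f).1
    have hd' : 0 < volume (lev d f) := hd
    by_contra hlt
    rw [lev_empty (not_le.1 hlt)] at hd'
    simp at hd'
  have hDs : DstarAlpha p α F = D := by
    have hmem : D = sInf ((fun f : HolderBall p α F =>
        DstarOn (fun x : ↥F => f.1 x) Set.univ) '' G) := by
      have : (fun f : HolderBall p α F =>
        DstarOn (fun x : ↥F => f.1 x) Set.univ) '' G = {D} := by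
        apply subset_antisymm
        · rintro _ ⟨f, hf, rfl⟩
          exact hval f hf
        · rintro _ rfl
          obtain ⟨f, hf⟩ := hGd.nonempty
          exact ⟨f, hf, hval f hf⟩
      rw [this, csInf_singleton]
    have hub : ∀ v ∈ {v : ℝ | ∃ G : Set (HolderBall p α F), Dense G ∧ IsGδ G ∧
        v = sInf ((fun f : HolderBall p α F =>
          DstarOn (fun x : ↥F => f.1 x) Set.univ) '' G)}, v ≤ D := by
      rintro _ ⟨G', hG'd, hG'δ, rfl⟩
      obtain ⟨f, hf, hf'⟩ := (hGd.inter_of_Gδ hGδ hG'δ hG'd).nonempty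
      rw [← hval f hf]
      refine csInf_le ⟨0, ?_⟩ ⟨f, hf', rfl⟩
      rintro _ ⟨g, -, rfl⟩
      exact hnn g
    apply le_antisymm
    · exact csSup_le ⟨D, G, hGd, hGδ, hmem⟩ hub
    · exact le_csSup ⟨D, hub⟩ ⟨G, hGd, hGδ, hmem⟩
  refine ⟨G, hGd, hGδ, fun f hf => ?_⟩
  rw [hDs]
  obtain ⟨h1, h2⟩ := hGsub hf
  have : CompactSpace ↥F := isCompact_iff_compactSpace.1 hF
  have hrm : MeasurableSet (range (fun x : ↥F => f.1 x)) :=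
    (isCompact_range f.1.continuous).measurableSet
  have a1 : ∀ᵐ y ∂(volume.restrict (Set.range (fun x : ↥F => f.1 x))), ∀ n : ℕ,
      y ∉ lev (D + 1 / ((n : ℝ) + 1)) f :=
    ae_all_iff.2 fun n => ae_restrict_of_ae (measure_eq_zero_iff_ae_notMem.1 (h1 n))
  have a2 : ∀ᵐ y ∂(volume.restrict (Set.range (fun x : ↥F => f.1 x))), ∀ n : ℕ,
      y ∈ lev (D - 1 / ((n : ℝ) + 1)) f := by
    refine ae_all_iff.2 fun n => ?_
    rw [ae_restrict_iff' hrm]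
    filter_upwards [measure_eq_zero_iff_ae_notMem.1 (h2 n).2] with y hy hyr
    by_contra hc
    exact hy ⟨hyr, hc⟩
  filter_upwards [a1, a2] with y hy1 hy2
  apply le_antisymm
  · have h4 : Tendsto (fun n : ℕ => ENNReal.ofReal (D + 1 / ((n : ℝ) + 1))) atTop
        (𝓝 (ENNReal.ofReal D)) := by
      apply ENNReal.tendsto_ofReal
      simpa using ht.const_add D
    refine ge_of_tendsto' h4 fun n => ?_
    exact (not_le.1 (hy1 n)).le
  · have h4 : Tendsto (fun n : ℕ => ENNReal.ofReal (D - 1 / ((n : ℝ) + 1))) atTop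
        (𝓝 (ENNReal.ofReal D)) := by
      apply ENNReal.tendsto_ofReal
      simpa using ht.const_sub D
    exact le_of_tendsto' h4 fun n => hy2 n

theorem stmt19 (p m : ℕ) (hm : 2 ≤ m) (F : Set (Euc p))
    (hF : IsCompact F) (hconn : IsConnected F) (hdiam : Metric.diam F ≤ 1)
    (φ : Fin m → Euc p → Euc p) (r : Fin m → ℝ)
    (hr : ∀ i, 0 < r i ∧ r i < 1)
    (hsim : ∀ i, ∀ u v, dist (φ i u) (φ i v) = r i * dist u v)
    (hself : F = ⋃ i, φ i '' F)
    (α : ℝ) (hα0 : 0 < α) (hα1 : α < 1) :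
    ∃ G : Set (HolderBall p α F), Dense G ∧ IsGδ G ∧
      ∀ f ∈ G,
        ∀ᵐ y ∂(volume.restrict (Set.range (fun x : ↥F => f.1 x))),
          dimH ((fun x : ↥F => f.1 x) ⁻¹' {y}) = ENNReal.ofReal (DstarAlpha p α F) := by
  have hmap : ∀ i, ∀ x ∈ F, φ i x ∈ F := fun i x hx => by
    rw [hself]
    exact mem_iUnion.2 ⟨i, x, hx, rfl⟩
  refine main_abs (Φ := fun i x => ⟨φ i x.1, hmap i x.1 x.2⟩) (r := r) hα0 hα1 hF hconn.nonempty
    (fun x y => (dist_le_diam_of_mem hF.isBounded x.2 y.2).trans hdiam) hr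
    (fun i u v => hsim i u.1 v.1) fun x => ?_
  have hx : x.1 ∈ ⋃ i, φ i '' F := by
    rw [← hself]; exact x.2
  obtain ⟨i, y, hy, hyx⟩ := mem_iUnion.1 hx
  exact ⟨i, ⟨y, hy⟩, Subtype.ext hyx⟩
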